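/- arXiv:2105.00793 — 4 statements merged into one kernel-verified Lean document; each statement's English description precedes it below -/
import Mathlib

section
/- Let L ∈ ℂ^{p×p} be an invertible doubly real-preserving matrix. A tubal matrix A ∈ K_p^{n×n} is orthogonal (i.e., A *_L A^⊤ = A^⊤ *_L A = I_n) if and only if for every k = 1, …, p the complex n×n matrix Φ_L(A)(k) is unitary. -/
open Matrix Complex

/-- The `L`-product `a ⊙_L b := L⁻¹ ((L a) ∘ (L b))`, with `∘` the Hadamard product. -/
noncomputable def odot {p : ℕ} (L : Matrix (Fin p) (Fin p) ℂ) (a b : Fin p → ℂ) :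
    Fin p → ℂ :=
  L⁻¹ *ᵥ ((L *ᵥ a) * (L *ᵥ b))

/-- Embedding of a real vector into `ℂ^p`. -/
def toC {p : ℕ} (a : Fin p → ℝ) : Fin p → ℂ := fun i => (a i : ℂ)

/-- A complex vector is real if all its components have zero imaginary part. -/
def IsRealVec {p : ℕ} (v : Fin p → ℂ) : Prop := ∀ k, (v k).im = 0

/-- `L` is real-preserving if `a ⊙_L b` is real whenever `a, b` are real. -/
def RealPreserving {p : ℕ} (L : Matrix (Fin p) (Fin p) ℂ) : Prop :=
  ∀ a b : Fin p → ℝ, IsRealVec (odot L (toC a) (toC b))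

/-- The map `ψ_L(a) := L⁻¹ (conj (L a))`, with entrywise complex conjugation. -/
noncomputable def psiL {p : ℕ} (L : Matrix (Fin p) (Fin p) ℂ) (a : Fin p → ℂ) : Fin p → ℂ :=
  L⁻¹ *ᵥ (star (L *ᵥ a))

/-- `L` is doubly real-preserving if it is real-preserving and `ψ_L` maps `ℝ^p` to `ℝ^p`. -/
def DoublyRealPreserving {p : ℕ} (L : Matrix (Fin p) (Fin p) ℂ) : Prop :=
  RealPreserving L ∧ ∀ a : Fin p → ℝ, IsRealVec (psiL L (toC a))

/-- The unit tubal scalar `e_L := L⁻¹ 𝟙`, where `𝟙` is the all-ones vector. -/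
noncomputable def unitE {p : ℕ} (L : Matrix (Fin p) (Fin p) ℂ) : Fin p → ℂ :=
  L⁻¹ *ᵥ (fun _ => 1)

/-- The tubal matrix product `A *_L B`, with `(i,j)` entry `Σ_l a_{il} ⊙_L b_{lj}`. -/
noncomputable def tprodC {p m s n : ℕ} (L : Matrix (Fin p) (Fin p) ℂ)
    (A : Fin m → Fin s → Fin p → ℂ) (B : Fin s → Fin n → Fin p → ℂ) :
    Fin m → Fin n → Fin p → ℂ :=
  fun i j => ∑ l, odot L (A i l) (B l j)

/-- The `k`-th slice `Φ_L(A)(k)`: the matrix with `(i,j)` entry the `k`-th component of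
`L a_{ij}`. -/
noncomputable def sliceC {p m n : ℕ} (L : Matrix (Fin p) (Fin p) ℂ)
    (A : Fin m → Fin n → Fin p → ℂ) (k : Fin p) : Matrix (Fin m) (Fin n) ℂ :=
  Matrix.of fun i j => (L *ᵥ A i j) k

/-- Entrywise embedding of a real tubal matrix into the complex setting. -/
def mapC {p m n : ℕ} (A : Fin m → Fin n → Fin p → ℝ) : Fin m → Fin n → Fin p → ℂ :=
  fun i j => toC (A i j)

/-- The transpose of a tubal matrix: `(A^⊤)_{ij} = ψ_L(a_{ji})`. -/
noncomputable def transC {p m n : ℕ} (L : Matrix (Fin p) (Fin p) ℂ)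
    (A : Fin m → Fin n → Fin p → ℂ) : Fin n → Fin m → Fin p → ℂ :=
  fun i j => psiL L (A j i)

/-- The identity tubal matrix: diagonal with diagonal entries `e_L`. -/
noncomputable def idC {p : ℕ} (L : Matrix (Fin p) (Fin p) ℂ) (n : ℕ) :
    Fin n → Fin n → Fin p → ℂ :=
  fun i j => if i = j then unitE L else 0

/-- A tubal matrix `A` is orthogonal if `A *_L A^⊤ = A^⊤ *_L A = I`. -/
noncomputable def OrthTubalC {p n : ℕ} (L : Matrix (Fin p) (Fin p) ℂ)
    (A : Fin n → Fin n → Fin p → ℂ) : Prop :=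
  tprodC L A (transC L A) = idC L n ∧ tprodC L (transC L A) A = idC L n

section Slices

variable {p m s n : ℕ} {L : Matrix (Fin p) (Fin p) ℂ}

theorem mulVec_inv_mulVec (hL : IsUnit L.det) (v : Fin p → ℂ) : L *ᵥ (L⁻¹ *ᵥ v) = v := by
  rw [Matrix.mulVec_mulVec, Matrix.mul_nonsing_inv _ hL, Matrix.one_mulVec]

/-- A tubal matrix is determined by its slices. -/
theorem eq_iff_forall_sliceC_eq (hL : IsUnit L.det) {A B : Fin m → Fin n → Fin p → ℂ} :
    A = B ↔ ∀ k, sliceC L A k = sliceC L B k := by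
  refine ⟨fun h _ => by rw [h], fun h => ?_⟩
  funext i j
  apply Matrix.mulVec_injective_of_isUnit ((Matrix.isUnit_iff_isUnit_det L).2 hL)
  funext k
  exact congrFun (congrFun (h k) i) j

theorem sliceC_tprodC (hL : IsUnit L.det) (A : Fin m → Fin s → Fin p → ℂ)
    (B : Fin s → Fin n → Fin p → ℂ) (k : Fin p) :
    sliceC L (tprodC L A B) k = sliceC L A k * sliceC L B k := by
  ext i j
  simp [sliceC, tprodC, odot, Matrix.mul_apply, Matrix.mulVec_sum, mulVec_inv_mulVec hL]

theorem sliceC_transC (hL : IsUnit L.det) (A : Fin m → Fin n → Fin p → ℂ) (k : Fin p) :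
    sliceC L (transC L A) k = (sliceC L A k)ᴴ := by
  ext i j
  simp [sliceC, transC, psiL, mulVec_inv_mulVec hL]

theorem sliceC_idC (hL : IsUnit L.det) (k : Fin p) : sliceC L (idC L n) k = 1 := by
  ext i j
  by_cases h : i = j <;> simp [sliceC, idC, unitE, mulVec_inv_mulVec hL, Matrix.one_apply, h]

end Slices

/-- Proposition 2.8: a tubal matrix `A` is orthogonal iff every slice `Φ_L(A)(k)` is a
unitary matrix. -/
theorem stmt10 {p n : ℕ} (L : Matrix (Fin p) (Fin p) ℂ) (hL : IsUnit L.det)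
    (hD : DoublyRealPreserving L) (A : Fin n → Fin n → Fin p → ℝ) :
    OrthTubalC L (mapC A) ↔ ∀ k, sliceC L (mapC A) k ∈ Matrix.unitaryGroup (Fin n) ℂ := by
  simp only [OrthTubalC, eq_iff_forall_sliceC_eq hL, sliceC_tprodC hL, sliceC_transC hL,
    sliceC_idC hL, ← forall_and, Matrix.unitaryGroup, Unitary.mem_iff,
    Matrix.star_eq_conjTranspose]
  exact forall_congr' fun _ => and_comm
end

section
/- Let L ∈ ℝ^{p×p} be an invertible real matrix (a doubly real-preserving transformation). Then every tubal matrix A ∈ K_p^{m×n} admits a T-SVD factorization: there exist an orthogonal tubal matrix U ∈ K_p^{m×m}, an orthogonal tubal matrix V ∈ K_p^{n×n}, and an s-diagonal tubal matrix S ∈ K_p^{m×n} such that A = U *_L S *_L V^⊤. -/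
open Matrix

/-- For a real invertible `L`, the `L`-product `a ⊙_L b := L⁻¹ ((L a) ∘ (L b))`,
with `∘` the Hadamard product. -/
noncomputable def odotR {p : ℕ} (L : Matrix (Fin p) (Fin p) ℝ) (a b : Fin p → ℝ) :
    Fin p → ℝ :=
  L⁻¹ *ᵥ ((L *ᵥ a) * (L *ᵥ b))

/-- The tubal matrix product `A *_L B`, with `(i,j)` entry `Σ_l a_{il} ⊙_L b_{lj}`. -/
noncomputable def tprodR {p m s n : ℕ} (L : Matrix (Fin p) (Fin p) ℝ)
    (A : Fin m → Fin s → Fin p → ℝ) (B : Fin s → Fin n → Fin p → ℝ) :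
    Fin m → Fin n → Fin p → ℝ :=
  fun i j => ∑ l, odotR L (A i l) (B l j)

/-- The transpose of a tubal matrix (for real `L`, `ψ_L` is the identity, so
`(A^⊤)_{ij} = a_{ji}`). -/
def transR {p m n : ℕ} (A : Fin m → Fin n → Fin p → ℝ) : Fin n → Fin m → Fin p → ℝ :=
  fun i j => A j i

/-- The identity tubal matrix: diagonal with diagonal entries `e_L := L⁻¹ 𝟙`. -/
noncomputable def idR {p : ℕ} (L : Matrix (Fin p) (Fin p) ℝ) (n : ℕ) :
    Fin n → Fin n → Fin p → ℝ :=
  fun i j => if i = j then L⁻¹ *ᵥ (fun _ => 1) else 0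

/-- A tubal matrix `A` is orthogonal if `A *_L A^⊤ = A^⊤ *_L A = I`. -/
noncomputable def OrthTubalR {p n : ℕ} (L : Matrix (Fin p) (Fin p) ℝ)
    (A : Fin n → Fin n → Fin p → ℝ) : Prop :=
  tprodR L A (transR A) = idR L n ∧ tprodR L (transR A) A = idR L n

/-- The `i`-th diagonal entry of a tubal matrix, for `i < min m n`. -/
def diagEntry {p m n : ℕ} (S : Fin m → Fin n → Fin p → ℝ) (i : Fin (min m n)) : Fin p → ℝ :=
  S (Fin.castLE (Nat.min_le_left m n) i) (Fin.castLE (Nat.min_le_right m n) i)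

/-- An s-diagonal tubal matrix (for real `L`): all off-diagonal entries vanish, and for
every `k`, `(L s_{11})(k) ≥ (L s_{22})(k) ≥ ⋯ ≥ (L s_{qq})(k) ≥ 0` where `q = min m n`. -/
def SDiagR {p m n : ℕ} (L : Matrix (Fin p) (Fin p) ℝ) (S : Fin m → Fin n → Fin p → ℝ) :
    Prop :=
  (∀ (i : Fin m) (j : Fin n), (i : ℕ) ≠ (j : ℕ) → S i j = 0) ∧
  (∀ (i : Fin (min m n)) (k : Fin p), 0 ≤ (L *ᵥ diagEntry S i) k) ∧
  (∀ (i j : Fin (min m n)), i ≤ j → ∀ k, (L *ᵥ diagEntry S j) k ≤ (L *ᵥ diagEntry S i) k)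

/-- Singular value decomposition of a linear map between finite-dimensional real inner product
spaces, in terms of orthonormal bases. -/
theorem LinearMap.exists_orthonormalBasis_singularValues
    {E F : Type*} [NormedAddCommGroup E] [InnerProductSpace ℝ E] [FiniteDimensional ℝ E]
    [NormedAddCommGroup F] [InnerProductSpace ℝ F] [FiniteDimensional ℝ F]
    {m n : ℕ} (hE : Module.finrank ℝ E = n) (hF : Module.finrank ℝ F = m) (T : E →ₗ[ℝ] F) :
    ∃ (u : OrthonormalBasis (Fin m) ℝ F) (v : OrthonormalBasis (Fin n) ℝ E),
      ∀ j : Fin n, T (v j) =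
        if h : (j : ℕ) < m then T.singularValues j • u ⟨j, h⟩ else 0 := by
  have hT := T.isSymmetric_adjoint_comp_self
  set v := hT.eigenvectorBasis hE with hv
  have inner_apply (i j : Fin n) :
      inner ℝ (T (v i)) (T (v j)) = if i = j then T.singularValues j ^ 2 else 0 := by
    rw [← LinearMap.adjoint_inner_right, ← LinearMap.comp_apply, hv,
      hT.apply_eigenvectorBasis hE, inner_smul_right, ← T.sq_singularValues_fin hE,
      orthonormal_iff_ite.mp (hT.eigenvectorBasis hE).orthonormal]
    simp
  have apply_eq_zero (j : Fin n) (hj : T.singularValues j = 0) : T (v j) = 0 := by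
    have := inner_apply j j
    rw [if_pos rfl, hj] at this
    simpa using this
  let w : Fin m → F := fun i =>
    if h : (i : ℕ) < n then (T.singularValues i)⁻¹ • T (v ⟨i, h⟩) else 0
  let s : Set (Fin m) := {i | T.singularValues i ≠ 0}
  have hs : Orthonormal ℝ (s.domRestrict w) := by
    rw [orthonormal_iff_ite]
    rintro ⟨i, hi⟩ ⟨j, hj⟩
    have lt_n (i : Fin m) (hi : i ∈ s) : (i : ℕ) < n := by
      by_contra! h
      exact hi (T.singularValues_of_finrank_le (hE.trans_le h))
    have hj_ne : T.singularValues j ≠ 0 := hj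
    simp only [Set.domRestrict_apply, w, dif_pos (lt_n i hi), dif_pos (lt_n j hj),
      inner_smul_left, inner_smul_right, inner_apply, Subtype.mk.injEq, Fin.ext_iff]
    split_ifs with hij
    · rw [hij]
      simp only [map_inv₀, conj_trivial]
      field_simp
    · simp
  obtain ⟨u, hu⟩ := hs.exists_orthonormalBasis_extension_of_card_eq (by simpa using hF)
  refine ⟨u, v, fun j => ?_⟩
  by_cases hj : T.singularValues j = 0
  · simp [apply_eq_zero j hj, hj]
  · have hjm : (j : ℕ) < m := by
      have := mt T.singularValues_eq_zero_iff_le_finrank_range.mpr hj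
      have := T.range.finrank_le
      omega
    rw [dif_pos hjm, hu ⟨j, hjm⟩ hj]
    simp [w, smul_smul, hj]

/-- The square matrix whose columns are an orthonormal basis is orthogonal. -/
theorem OrthonormalBasis.transpose_mul_self_of_coords {n : ℕ}
    (b : OrthonormalBasis (Fin n) ℝ (EuclideanSpace ℝ (Fin n))) :
    (Matrix.of fun i j => b j i)ᵀ * (Matrix.of fun i j => b j i) = 1 := by
  ext i j
  have h := orthonormal_iff_ite.mp b.orthonormal i j
  simp only [PiLp.inner_apply, RCLike.inner_apply, conj_trivial] at h
  simp only [mul_apply, transpose_apply, of_apply, one_apply, ← h]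
  exact Finset.sum_congr rfl fun _ _ => mul_comm _ _

/-- Singular value decomposition of a real matrix, with the singular values in decreasing order. -/
theorem Matrix.exists_svd {m n : ℕ} (M : Matrix (Fin m) (Fin n) ℝ) :
    ∃ (U : Matrix (Fin m) (Fin m) ℝ) (σ : ℕ → ℝ) (V : Matrix (Fin n) (Fin n) ℝ),
      Uᵀ * U = 1 ∧ Vᵀ * V = 1 ∧ (∀ i, 0 ≤ σ i) ∧ Antitone σ ∧
      M = U * (Matrix.of fun (i : Fin m) (j : Fin n) => if (i : ℕ) = j then σ i else 0) *
        Vᵀ := by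
  obtain ⟨u, v, h⟩ := (toEuclideanLin M).exists_orthonormalBasis_singularValues
    finrank_euclideanSpace_fin finrank_euclideanSpace_fin
  have hV := v.transpose_mul_self_of_coords
  refine ⟨of fun i j => u j i, _, of fun i j => v j i, u.transpose_mul_self_of_coords, hV,
    (toEuclideanLin M).singularValues_nonneg, (toEuclideanLin M).singularValues_antitone, ?_⟩
  have key : M * (of fun i j => v j i) = (of fun i j => u j i) *
      (of fun (i : Fin m) (j : Fin n) =>
        if (i : ℕ) = j then (toEuclideanLin M).singularValues i else 0) := by
    ext i j
    have hij := congrArg (fun x : EuclideanSpace ℝ (Fin m) => x i) (h j)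
    simp only [ofLp_toLpLin, toLin'_apply] at hij
    change (M *ᵥ (v j).ofLp) i = _
    rw [hij]
    simp only [mul_apply, of_apply]
    split_ifs with hjm
    · rw [Finset.sum_eq_single ⟨j, hjm⟩]
      · simp [mul_comm]
      · intro k _ hk
        rw [if_neg (fun e => hk (Fin.ext e)), mul_zero]
      · simp
    · symm
      refine Finset.sum_eq_zero fun k _ => ?_
      rw [if_neg (by omega), mul_zero]
  rw [← key, Matrix.mul_assoc, mul_eq_one_comm.mp hV, Matrix.mul_one]

/-- The `k`-th frontal slice of a tubal matrix in the transform domain. -/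
noncomputable def transformSlice {p m n : ℕ} (L : Matrix (Fin p) (Fin p) ℝ)
    (A : Fin m → Fin n → Fin p → ℝ) (k : Fin p) : Matrix (Fin m) (Fin n) ℝ :=
  of fun i j => (L *ᵥ A i j) k

/-- The tubal matrix with prescribed frontal slices in the transform domain. -/
noncomputable def ofTransformSlices {p m n : ℕ} (L : Matrix (Fin p) (Fin p) ℝ)
    (M : Fin p → Matrix (Fin m) (Fin n) ℝ) : Fin m → Fin n → Fin p → ℝ :=
  fun i j => L⁻¹ *ᵥ fun k => M k i j

section TransformSlice

variable {p m s n : ℕ} {L : Matrix (Fin p) (Fin p) ℝ}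

theorem mulVec_inv_mulVec_of_isUnit_det (hL : IsUnit L.det) (x : Fin p → ℝ) :
    L *ᵥ (L⁻¹ *ᵥ x) = x := by
  rw [mulVec_mulVec, mul_nonsing_inv L hL, one_mulVec]

theorem transformSlice_ofTransformSlices (hL : IsUnit L.det)
    (M : Fin p → Matrix (Fin m) (Fin n) ℝ) (k : Fin p) :
    transformSlice L (ofTransformSlices L M) k = M k := by
  ext i j
  simp [transformSlice, ofTransformSlices, -mulVec_mulVec, mulVec_inv_mulVec_of_isUnit_det hL]

theorem eq_of_transformSlice_eq (hL : IsUnit L.det) {A B : Fin m → Fin n → Fin p → ℝ}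
    (h : ∀ k, transformSlice L A k = transformSlice L B k) : A = B := by
  ext i j : 2
  apply mulVec_injective_of_isUnit ((isUnit_iff_isUnit_det L).mpr hL)
  ext k
  exact congrFun (congrFun (h k) i) j

theorem transformSlice_tprodR (hL : IsUnit L.det) (A : Fin m → Fin s → Fin p → ℝ)
    (B : Fin s → Fin n → Fin p → ℝ) (k : Fin p) :
    transformSlice L (tprodR L A B) k = transformSlice L A k * transformSlice L B k := by
  ext i j
  simp [transformSlice, tprodR, odotR, mul_apply, mulVec_sum, -mulVec_mulVec,
    mulVec_inv_mulVec_of_isUnit_det hL]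

theorem transformSlice_transR (A : Fin m → Fin n → Fin p → ℝ) (k : Fin p) :
    transformSlice L (transR A) k = (transformSlice L A k)ᵀ :=
  rfl

theorem transformSlice_idR (hL : IsUnit L.det) (k : Fin p) :
    transformSlice L (idR L n) k = 1 := by
  ext i j
  by_cases h : i = j <;>
    simp [transformSlice, idR, h, one_apply, -mulVec_mulVec, mulVec_inv_mulVec_of_isUnit_det hL]

theorem orthTubalR_ofTransformSlices (hL : IsUnit L.det) {M : Fin p → Matrix (Fin n) (Fin n) ℝ}
    (hM : ∀ k, (M k)ᵀ * M k = 1) : OrthTubalR L (ofTransformSlices L M) := by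
  constructor <;> refine eq_of_transformSlice_eq hL fun k => ?_ <;>
    rw [transformSlice_tprodR hL, transformSlice_transR, transformSlice_ofTransformSlices hL,
      transformSlice_idR hL]
  · exact mul_eq_one_comm.mp (hM k)
  · exact hM k

end TransformSlice

/-- T-SVD factorization (Theorem 2.10 for a real invertible transformation `L`): every
tubal matrix `A` factors as `A = U *_L S *_L V^⊤` with `U, V` orthogonal tubal matrices
and `S` an s-diagonal tubal matrix. -/
theorem stmt12 {p m n : ℕ} (L : Matrix (Fin p) (Fin p) ℝ) (hL : IsUnit L.det)
    (A : Fin m → Fin n → Fin p → ℝ) :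
    ∃ (U : Fin m → Fin m → Fin p → ℝ) (S : Fin m → Fin n → Fin p → ℝ)
      (V : Fin n → Fin n → Fin p → ℝ),
      OrthTubalR L U ∧ OrthTubalR L V ∧ SDiagR L S ∧
      A = tprodR L (tprodR L U S) (transR V) := by
  choose U σ V hU hV hσ hσ_anti hA using fun k => (transformSlice L A k).exists_svd
  refine ⟨ofTransformSlices L U,
    ofTransformSlices L fun k => of fun i j => if (i : ℕ) = j then σ k i else 0,
    ofTransformSlices L V, orthTubalR_ofTransformSlices hL hU, orthTubalR_ofTransformSlices hL hV,
    ⟨fun i j hij => ?_, fun i k => ?_, fun i j hij k => ?_⟩,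
    eq_of_transformSlice_eq hL fun k => ?_⟩
  · simp only [ofTransformSlices, of_apply, if_neg hij]
    exact mulVec_zero _
  · simp only [diagEntry, ofTransformSlices, mulVec_inv_mulVec_of_isUnit_det hL]
    simpa using hσ k i
  · simp only [diagEntry, ofTransformSlices, mulVec_inv_mulVec_of_isUnit_det hL]
    simpa using hσ_anti k hij
  · simp only [transformSlice_tprodR hL, transformSlice_transR,
      transformSlice_ofTransformSlices hL]
    exact hA k
end

section
/- Let L ∈ ℂ^{p×p} be a doubly real-preserving unitary matrix and let P ∈ ℝ^{p×p} be orthogonal. Then LP is a doubly real-preserving unitary matrix. -/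
open Matrix Complex

theorem toC_mulVec {p : ℕ} (P : Matrix (Fin p) (Fin p) ℝ) (a : Fin p → ℝ) :
    P.map Complex.ofReal *ᵥ toC a = toC (P *ᵥ a) :=
  funext fun i => (RingHom.map_mulVec Complex.ofRealHom P a i).symm

theorem IsRealVec.map_ofReal_mulVec {p : ℕ} (P : Matrix (Fin p) (Fin p) ℝ) {v : Fin p → ℂ}
    (hv : IsRealVec v) : IsRealVec (P.map Complex.ofReal *ᵥ v) := by
  have hv' : v = toC fun k => (v k).re := funext fun k => Complex.ext rfl (hv k)
  rw [hv', toC_mulVec]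
  exact fun k => Complex.ofReal_im _

theorem star_map_ofReal {p : ℕ} (P : Matrix (Fin p) (Fin p) ℝ) :
    star (P.map Complex.ofReal) = Pᵀ.map Complex.ofReal := by
  ext i j
  simp [Matrix.star_apply]

theorem map_ofReal_mem_unitaryGroup {p : ℕ} {P : Matrix (Fin p) (Fin p) ℝ}
    (hP : P ∈ Matrix.orthogonalGroup (Fin p) ℝ) :
    P.map Complex.ofReal ∈ Matrix.unitaryGroup (Fin p) ℂ := by
  rw [Matrix.mem_orthogonalGroup_iff] at hP
  rw [Matrix.mem_unitaryGroup_iff, star_map_ofReal]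
  have hmul := Matrix.map_mul (L := P) (M := Pᵀ) (f := Complex.ofRealHom)
  rw [hP] at hmul
  exact hmul.symm.trans (Matrix.map_one _ (map_zero Complex.ofRealHom) (map_one Complex.ofRealHom))

theorem inv_map_ofReal {p : ℕ} {P : Matrix (Fin p) (Fin p) ℝ}
    (hP : P ∈ Matrix.orthogonalGroup (Fin p) ℝ) :
    (P.map Complex.ofReal)⁻¹ = Pᵀ.map Complex.ofReal := by
  rw [Matrix.inv_eq_right_inv
    (Matrix.mem_unitaryGroup_iff.mp (map_ofReal_mem_unitaryGroup hP)), star_map_ofReal]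

/-- Proposition 3.1: the product of a doubly real-preserving unitary matrix `L` with any
real orthogonal matrix `P` is a doubly real-preserving unitary matrix. -/
theorem stmt13 {p : ℕ} (L : Matrix (Fin p) (Fin p) ℂ) (P : Matrix (Fin p) (Fin p) ℝ)
    (hD : DoublyRealPreserving L) (hU : L ∈ Matrix.unitaryGroup (Fin p) ℂ)
    (hP : P ∈ Matrix.orthogonalGroup (Fin p) ℝ) :
    DoublyRealPreserving (L * P.map Complex.ofReal) ∧
      L * P.map Complex.ofReal ∈ Matrix.unitaryGroup (Fin p) ℂ := by
  refine ⟨⟨fun a b => ?_, fun a => ?_⟩, mul_mem hU (map_ofReal_mem_unitaryGroup hP)⟩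
  · have h := (hD.1 (P *ᵥ a) (P *ᵥ b)).map_ofReal_mulVec Pᵀ
    simpa only [odot, Matrix.mul_inv_rev, inv_map_ofReal hP, ← Matrix.mulVec_mulVec,
      toC_mulVec] using h
  · have h := (hD.2 (P *ᵥ a)).map_ofReal_mulVec Pᵀ
    simpa only [psiL, Matrix.mul_inv_rev, inv_map_ofReal hP, ← Matrix.mulVec_mulVec,
      toC_mulVec] using h
end

section
/- Let L ∈ ℝ^{p×p} be an orthogonal matrix (a doubly real-preserving unitary transformation) and let A ∈ K_p^{m×n} have a T-SVD factorization A = U *_L S *_L V^⊤, where U ∈ K_p^{m×m} and V ∈ K_p^{n×n} are orthogonal tubal matrices and S is s-diagonal with diagonal entries s_{11}, …, s_{qq} (q = min{m,n}); write d_{ii} := L s_{ii} ∈ ℝ^p, so all d_{ii}(k) ≥ 0. For 1 ≤ j < pq, there exists a tubal matrix A_j ∈ K_p^{m×n} with Rank_b(A_j) ≤ j such that ‖A - A_j‖_F² equals the sum of the squares of all but the j largest elements of the multiset {d_{ii}(k) : 1 ≤ i ≤ q, 1 ≤ k ≤ p}, and for every B ∈ K_p^{m×n} with Rank_b(B) ≤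 j one has ‖A - B‖_F ≥ ‖A - A_j‖_F. -/
open Matrix

/-- The `k`-th slice `Φ_L(A)(k)`: the real matrix with `(i,j)` entry the `k`-th component
of `L a_{ij}`. -/
noncomputable def sliceR {p m n : ℕ} (L : Matrix (Fin p) (Fin p) ℝ)
    (A : Fin m → Fin n → Fin p → ℝ) (k : Fin p) : Matrix (Fin m) (Fin n) ℝ :=
  Matrix.of fun i j => (L *ᵥ A i j) k

/-- The B-rank `Rank_b(A) := Σ_k rank (Φ_L(A)(k))`. -/
noncomputable def rankB {p m n : ℕ} (L : Matrix (Fin p) (Fin p) ℝ)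
    (A : Fin m → Fin n → Fin p → ℝ) : ℕ :=
  ∑ k, (sliceR L A k).rank

/-- The Frobenius norm of a real tubal matrix. -/
noncomputable def frobR {p m n : ℕ} (A : Fin m → Fin n → Fin p → ℝ) : ℝ :=
  Real.sqrt (∑ i, ∑ j, ∑ k, (A i j k) ^ 2)

/-- The sum of the squares of the entries of a real matrix. -/
def sumSq {m n : ℕ} (M : Matrix (Fin m) (Fin n) ℝ) : ℝ := ∑ i, ∑ j, M i j ^ 2

theorem sumSq_eq_trace {m n : ℕ} (M : Matrix (Fin m) (Fin n) ℝ) :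
    sumSq M = (Mᵀ * M).trace := by
  simp only [sumSq, Matrix.trace, Matrix.diag, Matrix.mul_apply, Matrix.transpose_apply, sq]
  exact Finset.sum_comm

theorem sumSq_transpose {m n : ℕ} (M : Matrix (Fin m) (Fin n) ℝ) : sumSq Mᵀ = sumSq M :=
  Finset.sum_comm

theorem sumSq_mul_left {m n : ℕ} {U : Matrix (Fin m) (Fin m) ℝ} (hU : Uᵀ * U = 1)
    (M : Matrix (Fin m) (Fin n) ℝ) : sumSq (U * M) = sumSq M := by
  rw [sumSq_eq_trace, sumSq_eq_trace, Matrix.transpose_mul, Matrix.mul_assoc,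
    ← Matrix.mul_assoc Uᵀ, hU, Matrix.one_mul]

theorem sumSq_mul_right {m n : ℕ} {V : Matrix (Fin n) (Fin n) ℝ} (hV : V * Vᵀ = 1)
    (M : Matrix (Fin m) (Fin n) ℝ) : sumSq (M * V) = sumSq M := by
  rw [← sumSq_transpose, Matrix.transpose_mul, sumSq_mul_left (by simpa using hV),
    sumSq_transpose]

/-- The entry of a rectangular matrix at the `i`-th place of its main diagonal. -/
def diagAt {m n : ℕ} {α : Type*} (F : Fin m → Fin n → α) (i : Fin (min m n)) : α :=
  F (Fin.castLE (Nat.min_le_left m n) i) (Fin.castLE (Nat.min_le_right m n) i)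

theorem sum_sum_eq_sum_diagAt {m n : ℕ} (F : Fin m → Fin n → ℝ)
    (hF : ∀ (i : Fin m) (j : Fin n), (i : ℕ) ≠ j → F i j = 0) :
    ∑ i, ∑ j, F i j = ∑ i, diagAt F i := by
  rw [← Finset.sum_product']
  symm
  refine Finset.sum_of_injOn
    (fun i => (Fin.castLE (Nat.min_le_left m n) i, Fin.castLE (Nat.min_le_right m n) i))
    ?_ ?_ ?_ ?_
  · intro a _ b _ hab
    simpa using hab
  · intro a _
    simp
  · rintro ⟨a, b⟩ _ hab
    refine hF a b fun h => hab ?_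
    simp only [Finset.coe_univ, Set.image_univ, Set.mem_range]
    refine ⟨⟨a, lt_min a.2 (h ▸ b.2)⟩, ?_⟩
    ext <;> simp [h]
  · intro a _
    rfl

/-- The kernel of a real matrix has an orthonormal basis. -/
theorem exists_orthonormal_ker {m n : ℕ} (C : Matrix (Fin m) (Fin n) ℝ) :
    ∃ (d : ℕ) (v : Fin d → EuclideanSpace ℝ (Fin n)), Orthonormal ℝ v ∧
      (∀ a, C *ᵥ (v a).ofLp = 0) ∧ C.rank + d = n := by
  let f : EuclideanSpace ℝ (Fin n) →ₗ[ℝ] (Fin m → ℝ) :=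
    C.mulVecLin ∘ₗ (WithLp.linearEquiv 2 ℝ (Fin n → ℝ)).toLinearMap
  have hr : f.range = C.mulVecLin.range :=
    LinearMap.range_comp_of_range_eq_top _ (LinearEquiv.range _)
  refine ⟨_, fun a => (stdOrthonormalBasis ℝ f.ker a : EuclideanSpace ℝ (Fin n)), ?_, ?_, ?_⟩
  · exact (stdOrthonormalBasis ℝ f.ker).orthonormal.comp_linearIsometry f.ker.subtypeₗᵢ
  · intro a
    exact (stdOrthonormalBasis ℝ f.ker a).2
  · have h := f.finrank_range_add_finrank_ker
    rw [hr] at h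
    simpa [Matrix.rank] using h

theorem sum_sq_dotProduct_le {n d : ℕ} {v : Fin d → EuclideanSpace ℝ (Fin n)}
    (hv : Orthonormal ℝ v) (x : Fin n → ℝ) :
    ∑ a, (x ⬝ᵥ (v a).ofLp) ^ 2 ≤ ∑ l, x l ^ 2 := by
  have h := hv.sum_inner_products_le (x := WithLp.toLp 2 x) (s := Finset.univ)
  simpa [EuclideanSpace.norm_sq_eq, EuclideanSpace.inner_eq_star_dotProduct] using h

/-- For a rectangular diagonal `D` and any `C`, the squared distance from `D` to `C` dominates a
weighted sum of squared diagonal entries of `D` whose weights miss at most `rank C`. -/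
theorem exists_weights_le_sumSq_sub {m n : ℕ} (D C : Matrix (Fin m) (Fin n) ℝ)
    (hD : ∀ (i : Fin m) (j : Fin n), (i : ℕ) ≠ j → D i j = 0) :
    ∃ w : Fin (min m n) → ℝ, (∀ i, 0 ≤ w i) ∧ (∀ i, w i ≤ 1) ∧
      ∑ i, (1 - w i) ≤ C.rank ∧ ∑ i, w i * diagAt D i ^ 2 ≤ sumSq (D - C) := by
  obtain ⟨d, v, hv, hCv, hd⟩ := exists_orthonormal_ker C
  let u : Fin n → ℝ := fun l => ∑ a, (v a).ofLp l ^ 2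
  have hu1 : ∀ l, u l ≤ 1 := fun l => by
    have h := sum_sq_dotProduct_le hv (Pi.single l 1)
    simpa [u, Pi.single_apply, ite_pow] using h
  have hus : ∑ l, u l = d := by
    simp only [u]
    rw [Finset.sum_comm]
    have : ∀ a, ∑ l, (v a).ofLp l ^ 2 = 1 := fun a => by
      have h := EuclideanSpace.norm_sq_eq (v a)
      rw [hv.1 a] at h
      simpa using h.symm
    simp [this]
  refine ⟨fun i => u (Fin.castLE (Nat.min_le_right m n) i),
    fun i => Finset.sum_nonneg fun _ _ => sq_nonneg _, fun i => hu1 _, ?_, ?_⟩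
  · calc ∑ i : Fin (min m n), (1 - u (Fin.castLE (Nat.min_le_right m n) i))
        = ∑ l ∈ Finset.univ.map (Fin.castLEEmb (Nat.min_le_right m n)), (1 - u l) := by
          rw [Finset.sum_map]; rfl
      _ ≤ ∑ l, (1 - u l) := Finset.sum_le_univ_sum_of_nonneg fun l => sub_nonneg.2 (hu1 l)
      _ = C.rank := by
          rw [Finset.sum_sub_distrib, hus]
          have : (C.rank : ℝ) + d = n := by exact_mod_cast hd
          simp
          linarith
  · have hrow : ∀ i, ∑ a, ((D - C) i ⬝ᵥ (v a).ofLp) ^ 2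
        = ∑ l, u l * D i l ^ 2 := fun i => by
      have h1 : ∀ a, (D - C) i ⬝ᵥ (v a).ofLp = D i ⬝ᵥ (v a).ofLp := fun a => by
        have : C i ⬝ᵥ (v a).ofLp = 0 := congrFun (hCv a) i
        rw [← sub_zero (D i ⬝ᵥ (v a).ofLp), ← this, ← sub_dotProduct]
        rfl
      have h2 : ∀ a, (D i ⬝ᵥ (v a).ofLp) ^ 2 = ∑ l, (v a).ofLp l ^ 2 * D i l ^ 2 := fun a => by
        by_cases hi : (i : ℕ) < n
        · have hz : ∀ l : Fin n, l ≠ ⟨i, hi⟩ → D i l = 0 := fun l hl =>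
            hD i l fun h => hl (Fin.ext h.symm)
          rw [dotProduct, Finset.sum_eq_single ⟨i, hi⟩, Finset.sum_eq_single ⟨i, hi⟩]
          · ring
          · intro l _ hl; simp [hz l hl]
          · simp
          · intro l _ hl; simp [hz l hl]
          · simp
        · have hz : ∀ l : Fin n, D i l = 0 := fun l => hD i l fun h => hi (h ▸ l.2)
          simp [dotProduct, hz]
      simp only [h1, h2, u, Finset.sum_mul]
      exact Finset.sum_comm
    calc ∑ i, u (Fin.castLE (Nat.min_le_right m n) i) * diagAt D i ^ 2
        = ∑ i, ∑ l, u l * D i l ^ 2 :=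
          (sum_sum_eq_sum_diagAt (fun i l => u l * D i l ^ 2)
            fun i l h => by simp [hD i l h]).symm
      _ = ∑ i, ∑ a, ((D - C) i ⬝ᵥ (v a).ofLp) ^ 2 := by simp only [hrow]
      _ ≤ sumSq (D - C) := Finset.sum_le_sum fun i _ => sum_sq_dotProduct_le hv _

/-- The initial segment of length `N` of the sorted list of values of `f` is the multiset of values
of `f` on some set of indices. -/
theorem exists_finset_sort_take {ι : Type*} [Fintype ι] (f : ι → ℝ) (N : ℕ)
    (hN : N ≤ Fintype.card ι) :
    ∃ T : Finset ι, T.card = N ∧ (∀ x ∈ T, ∀ y ∉ T, f x ≤ f y) ∧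
      ((((Finset.univ : Finset ι).val.map f).sort (· ≤ ·)).take N : Multiset ℝ)
        = T.val.map f := by
  classical
  let r : ι → ι → Prop := fun a b => f a ≤ f b
  have : Std.Total r := ⟨fun a b => le_total (f a) (f b)⟩
  have : IsTrans ι r := ⟨fun a b c => le_trans⟩
  let l := (Finset.univ : Finset ι).toList.insertionSort r
  have hperm : l.Perm (Finset.univ : Finset ι).toList := List.perm_insertionSort r _
  have hnd : l.Nodup := hperm.nodup_iff.2 (Finset.nodup_toList _)
  have hpw : l.Pairwise r := List.pairwise_insertionSort r _
  have hlen : l.length = Fintype.card ι := by simp [l]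
  have hsort : ((Finset.univ : Finset ι).val.map f).sort (· ≤ ·) = l.map f := by
    refine List.Perm.eq_of_pairwise' (r := (· ≤ ·)) (Multiset.pairwise_sort _ _)
      (List.pairwise_map.2 hpw) ?_
    rw [← Multiset.coe_eq_coe, Multiset.sort_eq, ← Multiset.map_coe, Multiset.coe_eq_coe.2 hperm,
      Finset.coe_toList]
  have hT : (l.take N).toFinset.val = (l.take N : Multiset ι) := by
    rw [List.toFinset_val, (hnd.sublist (List.take_sublist N l)).dedup]
  refine ⟨(l.take N).toFinset, ?_, ?_, ?_⟩
  · rw [List.toFinset_card_of_nodup (hnd.sublist (List.take_sublist N l)), List.length_take, hlen,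
      min_eq_left hN]
  · intro x hx y hy
    rw [← List.take_append_drop N l, List.pairwise_append] at hpw
    refine hpw.2.2 x (List.mem_toFinset.1 hx) y ?_
    have : y ∈ l := hperm.mem_iff.2 (by simp)
    rw [← List.take_append_drop N l, List.mem_append] at this
    exact this.resolve_left fun h => hy (List.mem_toFinset.2 h)
  · rw [hsort, hT, ← List.map_take, Multiset.map_coe]

/-- A sum over the smallest values of `g` is a lower bound for every weighted sum of at least the
same total weight. -/
theorem sum_le_sum_weights {ι : Type*} [Fintype ι] (g w : ι → ℝ)
    (hg : ∀ x, 0 ≤ g x) (hw0 : ∀ x, 0 ≤ w x) (hw1 : ∀ x, w x ≤ 1) (T : Finset ι)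
    (hT : ∀ x ∈ T, ∀ y ∉ T, g x ≤ g y) (hcard : (T.card : ℝ) ≤ ∑ x, w x) :
    ∑ x ∈ T, g x ≤ ∑ x, w x * g x := by
  classical
  obtain rfl | hne := T.eq_empty_or_nonempty
  · simpa using Finset.sum_nonneg fun x _ => mul_nonneg (hw0 x) (hg x)
  obtain ⟨z, hz, hmax⟩ := T.exists_max_image g hne
  rw [← Finset.sum_add_sum_compl T w] at hcard
  rw [← Finset.sum_add_sum_compl T (fun x => w x * g x)]
  have h1 : ∑ x ∈ Tᶜ, w x * g z ≤ ∑ x ∈ Tᶜ, w x * g x := Finset.sum_le_sum fun x hx =>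
    mul_le_mul_of_nonneg_left (hT z hz x (Finset.mem_compl.1 hx)) (hw0 x)
  have h2 : ∑ x ∈ T, (1 - w x) * g x ≤ ∑ x ∈ T, (1 - w x) * g z := Finset.sum_le_sum fun x hx =>
    mul_le_mul_of_nonneg_left (hmax x hx) (sub_nonneg.2 (hw1 x))
  rw [← Finset.sum_mul] at h1 h2
  simp only [sub_mul, one_mul, Finset.sum_sub_distrib, Finset.sum_const, nsmul_eq_mul,
    mul_one] at h2
  nlinarith [hg z, mul_le_mul_of_nonneg_right hcard (hg z)]

section Slices

variable {p m n : ℕ} {L : Matrix (Fin p) (Fin p) ℝ}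

theorem sliceR_sub (A B : Fin m → Fin n → Fin p → ℝ) (k : Fin p) :
    sliceR L (A - B) k = sliceR L A k - sliceR L B k := by
  ext i j
  simp [sliceR, Matrix.mulVec_sub]

theorem sliceR_transR (A : Fin m → Fin n → Fin p → ℝ) (k : Fin p) :
    sliceR L (transR A) k = (sliceR L A k)ᵀ := rfl

theorem sliceR_tprodR {s : ℕ} (hL : IsUnit L.det) (A : Fin m → Fin s → Fin p → ℝ)
    (B : Fin s → Fin n → Fin p → ℝ) (k : Fin p) :
    sliceR L (tprodR L A B) k = sliceR L A k * sliceR L B k := by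
  ext i j
  simp [sliceR, tprodR, odotR, Matrix.mulVec_sum, Matrix.mul_apply, Matrix.mul_nonsing_inv _ hL]

theorem sliceR_idR (hL : IsUnit L.det) (k : Fin p) : sliceR L (idR L n) k = 1 := by
  ext i j
  by_cases h : i = j <;> simp [sliceR, idR, h, Matrix.one_apply, Matrix.mul_nonsing_inv _ hL]

/-- Every family of matrices is the family of slices of a tubal matrix. -/
theorem exists_sliceR_eq (hL : IsUnit L.det) (M : Fin p → Matrix (Fin m) (Fin n) ℝ) :
    ∃ A : Fin m → Fin n → Fin p → ℝ, ∀ k, sliceR L A k = M k := by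
  refine ⟨fun i j => L⁻¹ *ᵥ fun k => M k i j, fun k => ?_⟩
  ext i j
  simp [sliceR, Matrix.mul_nonsing_inv _ hL]

theorem frobR_sq_eq_sum_sumSq (hL : Lᵀ * L = 1) (A : Fin m → Fin n → Fin p → ℝ) :
    frobR A ^ 2 = ∑ k, sumSq (sliceR L A k) := by
  have hvec : ∀ x : Fin p → ℝ, ∑ k, (L *ᵥ x) k ^ 2 = ∑ k, x k ^ 2 := fun x => by
    have h : (L *ᵥ x) ⬝ᵥ (L *ᵥ x) = x ⬝ᵥ x := by
      rw [Matrix.dotProduct_mulVec, Matrix.vecMul_mulVec, ← Matrix.dotProduct_mulVec, hL,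
        Matrix.one_mulVec]
    simpa [dotProduct, sq] using h
  rw [frobR, Real.sq_sqrt (Finset.sum_nonneg fun _ _ => Finset.sum_nonneg fun _ _ =>
    Finset.sum_nonneg fun _ _ => sq_nonneg _)]
  simp only [sumSq, sliceR, Matrix.of_apply]
  symm
  rw [Finset.sum_comm]
  refine Finset.sum_congr rfl fun i _ => ?_
  rw [Finset.sum_comm]
  exact Finset.sum_congr rfl fun j _ => hvec _

end Slices

/-- Theorem 3.5 (second Eckart–Young like theorem), for a real orthogonal transformation
`L`: if `A = U *_L S *_L V^⊤` is a T-SVD of `A`, with `d_{ii} := L s_{ii}`, then for every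
`1 ≤ j < p·min m n` there is a tubal matrix `A_j` of B-rank at most `j` such that
`‖A - A_j‖_F²` equals the sum of squares of all but the `j` largest members of the multiset
`{d_{ii}(k)}`, and `A_j` is a best B-rank-`j` approximation of `A`. -/
theorem stmt19 {p m n : ℕ} (L : Matrix (Fin p) (Fin p) ℝ)
    (hL : L ∈ Matrix.orthogonalGroup (Fin p) ℝ)
    (A : Fin m → Fin n → Fin p → ℝ) (U : Fin m → Fin m → Fin p → ℝ)
    (S : Fin m → Fin n → Fin p → ℝ) (V : Fin n → Fin n → Fin p → ℝ)
    (hOU : OrthTubalR L U) (hOV : OrthTubalR L V) (hS : SDiagR L S)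
    (hA : A = tprodR L (tprodR L U S) (transR V))
    (j : ℕ) (hj1 : 1 ≤ j) (hj2 : j < p * min m n) :
    ∃ Aj : Fin m → Fin n → Fin p → ℝ,
      rankB L Aj ≤ j ∧
      frobR (A - Aj) ^ 2 =
        (((((Finset.univ : Finset (Fin (min m n) × Fin p)).val.map
              (fun ik => (L *ᵥ diagEntry S ik.1) ik.2)).sort (· ≤ ·)).take
            (p * min m n - j)).map (fun x => x ^ 2)).sum ∧
      ∀ B : Fin m → Fin n → Fin p → ℝ, rankB L B ≤ j → frobR (A - Aj) ≤ frobR (A - B) := by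
  classical
  have hLL : Lᵀ * L = 1 := by
    simpa [Matrix.star_eq_conjTranspose] using (Matrix.mem_orthogonalGroup_iff' (Fin p) ℝ).1 hL
  have hdet : IsUnit L.det := Matrix.isUnit_det_of_left_inverse hLL
  have hU1 : ∀ k, (sliceR L U k)ᵀ * sliceR L U k = 1 := fun k => by
    rw [← sliceR_transR, ← sliceR_tprodR hdet, hOU.2, sliceR_idR hdet]
  have hV1 : ∀ k, (sliceR L V k)ᵀ * sliceR L V k = 1 := fun k => by
    rw [← sliceR_transR, ← sliceR_tprodR hdet, hOV.2, sliceR_idR hdet]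
  have hU2 : ∀ k, sliceR L U k * (sliceR L U k)ᵀ = 1 := fun k => mul_eq_one_comm.1 (hU1 k)
  have hV2 : ∀ k, sliceR L V k * (sliceR L V k)ᵀ = 1 := fun k => mul_eq_one_comm.1 (hV1 k)
  have hAk : ∀ k, sliceR L A k = sliceR L U k * sliceR L S k * (sliceR L V k)ᵀ := fun k => by
    rw [hA, sliceR_tprodR hdet, sliceR_tprodR hdet, sliceR_transR]
  have hSk : ∀ k (i : Fin m) (l : Fin n), (i : ℕ) ≠ l → sliceR L S k i l = 0 := fun k i l h => by
    simp [sliceR, hS.1 i l h]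
  have hconj : ∀ k (M : Matrix (Fin m) (Fin n) ℝ),
      sumSq (sliceR L U k * M * (sliceR L V k)ᵀ) = sumSq M := fun k M => by
    rw [sumSq_mul_right (by simpa using hV1 k), sumSq_mul_left (hU1 k)]
  let σ : Fin (min m n) × Fin p → ℝ := fun ik => (L *ᵥ diagEntry S ik.1) ik.2
  have hσ : ∀ ik, 0 ≤ σ ik := fun ik => hS.2.1 ik.1 ik.2
  obtain ⟨T, hTcard, hTle, hTval⟩ := exists_finset_sort_take σ (p * min m n - j)
    (by simp [mul_comm])
  have hcompl : Tᶜ.card = j := by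
    rw [Finset.card_compl, hTcard]
    simp only [Fintype.card_prod, Fintype.card_fin, mul_comm (min m n) p]
    omega
  let c : Fin p → Fin n → ℝ := fun k l =>
    if ∃ i, Fin.castLE (Nat.min_le_right m n) i = l ∧ (i, k) ∉ T then 1 else 0
  have hc : ∀ k i, c k (Fin.castLE (Nat.min_le_right m n) i) = if (i, k) ∉ T then 1 else 0 :=
    fun k i => by simp [c]
  let D : Fin p → Matrix (Fin m) (Fin n) ℝ := fun k => sliceR L S k * Matrix.diagonal (c k)
  obtain ⟨Aj, hAj⟩ := exists_sliceR_eq hdet fun k => sliceR L U k * D k * (sliceR L V k)ᵀ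
  have hrank : rankB L Aj ≤ j := by
    calc rankB L Aj ≤ ∑ k, (Finset.univ.filter fun i => (i, k) ∈ Tᶜ).card := by
          refine Finset.sum_le_sum fun k _ => ?_
          rw [hAj]
          calc _ ≤ (Matrix.diagonal (c k)).rank :=
                (Matrix.rank_mul_le_left _ _).trans <|
                  (Matrix.rank_mul_le_right _ _).trans (Matrix.rank_mul_le_right _ _)
            _ = (Finset.univ.filter fun l => c k l ≠ 0).card := by
                rw [Matrix.rank_diagonal, Fintype.card_subtype]
            _ ≤ ((Finset.univ.filter fun i => (i, k) ∈ Tᶜ).image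
                  (Fin.castLE (Nat.min_le_right m n))).card := by
                refine Finset.card_le_card fun l hl => ?_
                simp only [c, Finset.mem_filter, Finset.mem_univ, true_and, ne_eq,
                  ite_eq_right_iff, one_ne_zero, imp_false, not_not] at hl
                obtain ⟨i, hi, hik⟩ := hl
                exact Finset.mem_image.2 ⟨i, by simpa using hik, hi⟩
            _ ≤ _ := Finset.card_image_le
      _ = Tᶜ.card := by
          simp only [Finset.card_filter]
          rw [← Finset.sum_product_right', Finset.univ_product_univ, ← Finset.card_filter]
          exact congrArg Finset.card (Finset.filter_univ_mem _)
      _ = j := hcompl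
  have herr : frobR (A - Aj) ^ 2 = ∑ x ∈ T, σ x ^ 2 := by
    have hk : ∀ k, sumSq (sliceR L (A - Aj) k)
        = ∑ i, if (i, k) ∈ T then σ (i, k) ^ 2 else 0 := fun k => by
      rw [sliceR_sub, hAk, hAj, ← Matrix.sub_mul, ← Matrix.mul_sub, hconj, sumSq,
        sum_sum_eq_sum_diagAt _ fun i l h => by simp [D, hSk k i l h]]
      refine Finset.sum_congr rfl fun i _ => ?_
      simp only [diagAt, D, Matrix.sub_apply, Matrix.mul_diagonal, hc]
      by_cases h : (i, k) ∈ T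
      · simp [h, sliceR, σ, diagEntry]
      · simp [h]
    rw [frobR_sq_eq_sum_sumSq hLL]
    simp only [hk]
    rw [← Finset.sum_product_right', Finset.univ_product_univ, ← Finset.sum_filter]
    simp
  refine ⟨Aj, hrank, ?_, fun B hB => ?_⟩
  · rw [herr, ← Multiset.sum_coe, ← Multiset.map_coe, hTval, Multiset.map_map]
    rfl
  · refine (sq_le_sq₀ (a := frobR (A - Aj)) (b := frobR (A - B)) (Real.sqrt_nonneg _)
      (Real.sqrt_nonneg _)).1 ?_
    rw [herr, frobR_sq_eq_sum_sumSq hLL]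
    choose w hw0 hw1 hws hwle using fun k => exists_weights_le_sumSq_sub (sliceR L S k)
      ((sliceR L U k)ᵀ * sliceR L B k * sliceR L V k) (hSk k)
    have hdist : ∀ k, sumSq (sliceR L (A - B) k)
        = sumSq (sliceR L S k - (sliceR L U k)ᵀ * sliceR L B k * sliceR L V k) := fun k => by
      have hBk : sliceR L B k = sliceR L U k *
          ((sliceR L U k)ᵀ * sliceR L B k * sliceR L V k) * (sliceR L V k)ᵀ := by
        rw [← Matrix.mul_assoc, ← Matrix.mul_assoc, hU2, Matrix.one_mul, Matrix.mul_assoc, hV2,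
          Matrix.mul_one]
      conv_lhs => rw [sliceR_sub, hAk, hBk, ← Matrix.sub_mul, ← Matrix.mul_sub, hconj]
    have htotal : ∑ x : Fin (min m n) × Fin p, (1 - w x.2 x.1) ≤ j := by
      have hk : ∀ k, ∑ i, (1 - w k i) ≤ ((sliceR L B k).rank : ℝ) := fun k =>
        (hws k).trans <| Nat.cast_le.2 <|
          (Matrix.rank_mul_le_left _ _).trans (Matrix.rank_mul_le_right _ _)
      have hB' : ∑ k, ((sliceR L B k).rank : ℝ) ≤ j := by
        rw [← Nat.cast_sum]
        exact Nat.cast_le.2 hB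
      rw [← Finset.univ_product_univ, Finset.sum_product_right]
      exact (Finset.sum_le_sum fun k _ => hk k).trans hB'
    calc ∑ x ∈ T, σ x ^ 2
        ≤ ∑ x : Fin (min m n) × Fin p, w x.2 x.1 * σ x ^ 2 := by
          refine sum_le_sum_weights (fun x => σ x ^ 2) (fun x => w x.2 x.1)
            (fun x => sq_nonneg _) (fun x => hw0 _ _) (fun x => hw1 _ _) T
            (fun x hx y hy => pow_le_pow_left₀ (hσ x) (hTle x hx y hy) 2) ?_
          rw [hTcard, Nat.cast_sub hj2.le]
          simp only [Finset.sum_sub_distrib, Finset.sum_const, Finset.card_univ,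
            Fintype.card_prod, Fintype.card_fin, nsmul_eq_mul, mul_one] at htotal
          push_cast at htotal ⊢
          linarith
      _ = ∑ k, ∑ i, w k i * diagAt (sliceR L S k) i ^ 2 := by
          rw [← Finset.univ_product_univ, Finset.sum_product_right]
          rfl
      _ ≤ ∑ k, sumSq (sliceR L (A - B) k) :=
          Finset.sum_le_sum fun k _ => (hwle k).trans (hdist k).ge
end
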